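/- arXiv:1003.1096 — 2 statements merged into one kernel-verified Lean document; each statement's English description precedes it below -/
import Mathlib

section
/- Let X be a connected simple graph having a cut, and let C be a cut of X. Then the set M(C) of all minimal cuts of X which are not nested with C is finite. -/
/-- The set of edges of `G` with one endpoint in `C` and one endpoint in `D`. -/
def edgesBetween {V : Type*} (G : SimpleGraph V) (C D : Set V) : Set (Sym2 V) :=
  {e | e ∈ G.edgeSet ∧ ∃ x ∈ C, ∃ y ∈ D, e = s(x, y)}

/-- The edge boundary `δC` of a set of vertices `C`. -/
def edgeBoundary {V : Type*} (G : SimpleGraph V) (C : Set V) : Set (Sym2 V) :=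
  edgesBetween G C Cᶜ

/-- A set of vertices is connected if the induced subgraph is connected. -/
def ConnSet {V : Type*} (G : SimpleGraph V) (C : Set V) : Prop :=
  (G.induce C).Connected

/-- A set of vertices contains a ray: a one-way infinite path all of whose
vertices lie in the set. -/
def HasRay {V : Type*} (G : SimpleGraph V) (C : Set V) : Prop :=
  ∃ r : ℕ → V, Function.Injective r ∧ (∀ n, G.Adj (r n) (r (n + 1))) ∧ ∀ n, r n ∈ C

/-- A cut: `δC` is finite, `C` and `Cᶜ` are connected and both contain a ray. -/
def IsCut {V : Type*} (G : SimpleGraph V) (C : Set V) : Prop :=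
  (edgeBoundary G C).Finite ∧ ConnSet G C ∧ ConnSet G Cᶜ ∧ HasRay G C ∧ HasRay G Cᶜ

/-- A minimal cut: a cut whose edge boundary has the minimal cardinality `κ`
among all cuts. -/
def IsMinCut {V : Type*} (G : SimpleGraph V) (C : Set V) : Prop :=
  IsCut G C ∧ ∀ D : Set V, IsCut G D → (edgeBoundary G C).ncard ≤ (edgeBoundary G D).ncard

/-- Two sets of vertices are nested. -/
def Nested {V : Type*} (C D : Set V) : Prop :=
  C ⊆ D ∨ D ⊆ C ∨ C ∩ D = ∅ ∨ C ∪ D = Set.univ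

/-- `M(C)`: the set of minimal cuts which are not nested with `C`. -/
def Mset {V : Type*} (G : SimpleGraph V) (C : Set V) : Set (Set V) :=
  {D : Set V | IsMinCut G D ∧ ¬ Nested D C}

theorem exists_mem_edges_edgeBoundary {V : Type*} {G : SimpleGraph V} {D : Set V} {u v : V}
    (p : G.Walk u v) (h : ¬ (u ∈ D ↔ v ∈ D)) : ∃ e ∈ p.edges, e ∈ edgeBoundary G D := by
  by_cases hu : u ∈ D
  · have hv : v ∉ D := fun hv => h ⟨fun _ => hv, fun _ => hu⟩
    obtain ⟨d, hd, h1, h2⟩ := p.exists_boundary_dart D hu hv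
    exact ⟨d.edge, List.mem_map_of_mem hd, d.adj, d.fst, h1, d.snd, h2, rfl⟩
  · have hv : v ∈ D := by by_contra hv; exact h ⟨fun h => absurd h hu, fun h => absurd h hv⟩
    obtain ⟨d, hd, h1, h2⟩ := p.exists_boundary_dart Dᶜ hu (fun h => h hv)
    exact ⟨d.edge, List.mem_map_of_mem hd, d.adj, d.snd, not_not.mp h2, d.fst, h1, Sym2.eq_swap⟩

/-- A connected set meeting both `C` and its complement contains an edge of `δC`. -/
theorem ConnSet.exists_adj {V : Type*} {G : SimpleGraph V} {C D : Set V} (hD : ConnSet G D)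
    {a b : V} (ha : a ∈ D) (hb : b ∈ D) (haC : a ∈ C) (hbC : b ∉ C) :
    ∃ x ∈ D, ∃ y ∈ D, G.Adj x y ∧ x ∈ C ∧ y ∉ C := by
  obtain ⟨p⟩ := hD.preconnected ⟨a, ha⟩ ⟨b, hb⟩
  obtain ⟨d, -, h1, h2⟩ := p.exists_boundary_dart (Subtype.val ⁻¹' C) haC hbC
  exact ⟨d.fst, d.fst.2, d.snd, d.snd.2, d.adj, h1, h2⟩

theorem ConnSet.reachable {V : Type*} {G : SimpleGraph V} {D : Set V} (hD : ConnSet G D)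
    {a b : V} (ha : a ∈ D) (hb : b ∈ D) : G.Reachable a b :=
  (hD.preconnected ⟨a, ha⟩ ⟨b, hb⟩).map (SimpleGraph.Embedding.induce D).toHom

/-- Deleting an edge leaving `D` keeps `D` connected. -/
theorem ConnSet.deleteEdges {V : Type*} {G : SimpleGraph V} {D : Set V} (hD : ConnSet G D)
    {x y : V} (h : x ∉ D ∨ y ∉ D) : ConnSet (G.deleteEdges {s(x, y)}) D := by
  refine hD.mono fun a b hab => ?_
  have ha := a.2
  have hb := b.2
  simp only [SimpleGraph.comap_adj, Function.Embedding.subtype_apply,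
    SimpleGraph.deleteEdges_adj, Set.mem_singleton_iff, Sym2.eq_iff] at hab ⊢
  refine ⟨hab, ?_⟩
  rintro (⟨h1, h2⟩ | ⟨h1, h2⟩) <;> subst h1 h2 <;> tauto

theorem edgeBoundary_deleteEdges {V : Type*} (G : SimpleGraph V) (D : Set V) (e : Sym2 V) :
    edgeBoundary (G.deleteEdges {e}) D = edgeBoundary G D \ {e} := by
  ext f
  simp only [edgeBoundary, edgesBetween, SimpleGraph.edgeSet_deleteEdges, Set.mem_sdiff,
    Set.mem_ofPred_eq]
  tauto

/-- Only finitely many connected sets with connected complement have an edge boundary of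
size `n` containing a given edge. -/
theorem finite_setOf_mem_edgeBoundary {V : Type*} (n : ℕ) (G : SimpleGraph V) (e : Sym2 V) :
    {D : Set V | ConnSet G D ∧ ConnSet G Dᶜ ∧ (edgeBoundary G D).encard = n ∧
      e ∈ edgeBoundary G D}.Finite := by
  induction n generalizing G e with
  | zero =>
    refine Set.finite_empty.subset ?_
    rintro D ⟨-, -, h, he⟩
    rw [Nat.cast_zero, Set.encard_eq_zero] at h
    simp [h] at he
  | succ n ih =>
    induction e using Sym2.ind with | _ x y
    set H := G.deleteEdges {s(x, y)} with hH
    have key : ∀ D : Set V, s(x, y) ∈ edgeBoundary G D → x ∈ D ∧ y ∉ D ∨ y ∈ D ∧ x ∉ D := by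
      rintro D ⟨-, a, ha, b, hb, hab⟩
      rcases Sym2.eq_iff.mp hab with ⟨rfl, rfl⟩ | ⟨rfl, rfl⟩
      · exact Or.inl ⟨ha, hb⟩
      · exact Or.inr ⟨ha, hb⟩
    by_cases hr : H.Reachable x y
    · obtain ⟨p⟩ := hr
      refine ((List.finite_toSet p.edges).biUnion fun f _ => ih H f).subset ?_
      rintro D ⟨h1, h2, h3, h4⟩
      have hk := key D h4
      obtain ⟨f, hf, hfD⟩ := exists_mem_edges_edgeBoundary (D := D) p (by tauto)
      refine Set.mem_biUnion (x := f) hf ⟨h1.deleteEdges (by tauto),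
        h2.deleteEdges (by simp only [Set.mem_compl_iff]; tauto), ?_, hfD⟩
      rw [hH, edgeBoundary_deleteEdges]
      have := Set.encard_sdiff_singleton_add_one h4
      rw [h3, Nat.cast_add, Nat.cast_one] at this
      exact (ENat.addLECancellable_of_ne_top ENat.one_ne_top).inj_left.mp this
    · refine (Set.toFinite {{v | H.Reachable x v}, {v | H.Reachable y v}}).subset ?_
      rintro D ⟨h1, h2, -, h4⟩
      have hk := key D h4
      have h1' : ConnSet H D := h1.deleteEdges (by tauto)
      have h2' : ConnSet H Dᶜ := h2.deleteEdges (by simp only [Set.mem_compl_iff]; tauto)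
      rcases hk with ⟨hx, hy⟩ | ⟨hy, hx⟩
      · left
        ext v
        refine ⟨fun hv => h1'.reachable hx hv, fun hv => ?_⟩
        by_contra hvD
        exact hr (hv.trans (h2'.reachable hvD hy))
      · right
        ext v
        refine ⟨fun hv => h1'.reachable hy hv, fun hv => ?_⟩
        by_contra hvD
        exact hr (hv.trans (h2'.reachable hvD hx)).symm

/-- For a finite set `F` of vertices of a connected graph, finitely many edges suffice to meet
the boundary of every vertex set separating `F`. -/
theorem exists_finite_edges_of_separates {V : Type*} {G : SimpleGraph V} (hG : G.Connected)
    {F : Set V} (hF : F.Finite) : ∃ E : Set (Sym2 V), E.Finite ∧ ∀ D : Set V, ∀ a ∈ F, ∀ b ∈ F,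
      a ∈ D → b ∉ D → ∃ e ∈ E, e ∈ edgeBoundary G D := by
  obtain ⟨v₀⟩ := hG.nonempty
  have p : ∀ v, G.Walk v₀ v := fun v => (hG.preconnected v₀ v).some
  refine ⟨⋃ v ∈ F, {e | e ∈ (p v).edges}, hF.biUnion fun v _ => List.finite_toSet _, ?_⟩
  intro D a ha b hb haD hbD
  have : ∃ c ∈ F, ¬ (v₀ ∈ D ↔ c ∈ D) := by
    by_cases h : v₀ ∈ D
    · exact ⟨b, hb, by tauto⟩
    · exact ⟨a, ha, by tauto⟩
  obtain ⟨c, hc, h⟩ := this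
  obtain ⟨e, he, heD⟩ := exists_mem_edges_edgeBoundary (p c) h
  exact ⟨e, Set.mem_biUnion hc he, heD⟩

/-- For a cut `C` of a connected graph having a cut, the set `M(C)` of minimal cuts
not nested with `C` is finite. -/
theorem Mset_finite {V : Type*} (G : SimpleGraph V) (hG : G.Connected)
    (hcut : ∃ A : Set V, IsCut G A) (C : Set V) (hC : IsCut G C) :
    (Mset G C).Finite := by
  rcases (Mset G C).eq_empty_or_nonempty with h | ⟨D₀, hD₀, -⟩
  · rw [h]; exact Set.finite_empty
  have hF : (⋃ e ∈ edgeBoundary G C, {v | v ∈ e}).Finite :=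
    hC.1.biUnion fun e _ => by
      induction e using Sym2.ind with | _ x y
      exact (Set.toFinite {x, y}).subset fun v hv => by simpa using hv
  obtain ⟨E, hE, hsep⟩ := exists_finite_edges_of_separates hG hF
  refine (hE.biUnion fun e _ =>
    finite_setOf_mem_edgeBoundary (edgeBoundary G D₀).ncard G e).subset ?_
  rintro D ⟨hD, hn⟩
  obtain ⟨hfin, hc, hc', -, -⟩ := hD.1
  simp only [Nested, not_or, Set.not_subset, ← ne_eq, ← Set.nonempty_iff_ne_empty,
    Set.ne_univ_iff_exists_notMem, Set.mem_union] at hn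
  obtain ⟨⟨a, haD, haC⟩, ⟨b, hbC, hbD⟩, ⟨c, hcD, hcC⟩, ⟨d, hd⟩⟩ := hn
  obtain ⟨x, hx, y, -, hxy, hxC, hyC⟩ := hc.exists_adj hcD haD hcC haC
  obtain ⟨z, hz, w, -, hzw, hzC, hwC⟩ := hc'.exists_adj (b := d) hbD hd.1 hbC hd.2
  obtain ⟨e, he, heD⟩ := hsep D x
    (Set.mem_biUnion (x := s(x, y)) ⟨hxy, x, hxC, y, hyC, rfl⟩ (Sym2.mem_mk_left x y)) z
    (Set.mem_biUnion (x := s(z, w)) ⟨hzw, z, hzC, w, hwC, rfl⟩ (Sym2.mem_mk_left z w)) hx hz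
  refine Set.mem_biUnion he ⟨hc, hc', ?_, heD⟩
  rw [← hfin.cast_ncard_eq, le_antisymm (hD.2 _ hD₀.1) (hD₀.2 _ hD.1)]
end

section
/- Let X be a connected simple graph having a cut. Then any two optimally nested minimal cuts of X are nested with each other. -/
/-- A minimal cut is optimally nested if `m(C)` is minimal among all minimal cuts. -/
def OptimallyNested {V : Type*} (G : SimpleGraph V) (C : Set V) : Prop :=
  IsMinCut G C ∧ ∀ D : Set V, IsMinCut G D → (Mset G C).ncard ≤ (Mset G D).ncard

section Boundary

variable {V : Type*} {G : SimpleGraph V} {A C D E : Set V} {x y : V}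

theorem mk_mem_edgeBoundary :
    s(x, y) ∈ edgeBoundary G C ↔ G.Adj x y ∧ ¬ (x ∈ C ↔ y ∈ C) := by
  simp only [edgeBoundary, edgesBetween, Set.mem_ofPred_eq, SimpleGraph.mem_edgeSet]
  refine and_congr_right fun _ => ⟨?_, fun h => ?_⟩
  · rintro ⟨a, ha, b, hb, hab⟩
    rcases Sym2.eq_iff.1 hab with ⟨rfl, rfl⟩ | ⟨rfl, rfl⟩
    · exact fun h => hb (h.1 ha)
    · exact fun h => hb (h.2 ha)
  · by_cases hx : x ∈ C
    · exact ⟨x, hx, y, fun hy => h ⟨fun _ => hy, fun _ => hx⟩, rfl⟩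
    · exact ⟨y, by tauto, x, hx, Sym2.eq_swap⟩

theorem edgeBoundary_compl : edgeBoundary G Cᶜ = edgeBoundary G C := by
  ext e
  induction e with | _ x y => simp only [mk_mem_edgeBoundary, Set.mem_compl_iff]; tauto

/-- Submodularity of the boundary with respect to two opposite corners. -/
theorem ncard_edgeBoundary_corners_le (hC : (edgeBoundary G C).Finite)
    (hD : (edgeBoundary G D).Finite) :
    (edgeBoundary G (C ∩ D)).Finite ∧ (edgeBoundary G (Cᶜ ∩ Dᶜ)).Finite ∧
    (edgeBoundary G (C ∩ D)).ncard + (edgeBoundary G (Cᶜ ∩ Dᶜ)).ncard ≤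
      (edgeBoundary G C).ncard + (edgeBoundary G D).ncard := by
  have hU : edgeBoundary G (C ∩ D) ∪ edgeBoundary G (Cᶜ ∩ Dᶜ) ⊆
      edgeBoundary G C ∪ edgeBoundary G D := by
    intro e
    induction e with | _ x y =>
    simp only [Set.mem_union, mk_mem_edgeBoundary, Set.mem_inter_iff, Set.mem_compl_iff]
    tauto
  have hI : edgeBoundary G (C ∩ D) ∩ edgeBoundary G (Cᶜ ∩ Dᶜ) ⊆
      edgeBoundary G C ∩ edgeBoundary G D := by
    intro e
    induction e with | _ x y =>
    simp only [mk_mem_edgeBoundary, Set.mem_inter_iff, Set.mem_compl_iff]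
    tauto
  have hfin := (hC.union hD).subset hU
  have h₁ := hfin.subset Set.subset_union_left
  have h₂ := hfin.subset Set.subset_union_right
  refine ⟨h₁, h₂, ?_⟩
  rw [← Set.ncard_union_add_ncard_inter _ _ h₁ h₂, ← Set.ncard_union_add_ncard_inter _ _ hC hD]
  exact add_le_add (Set.ncard_le_ncard hU (hC.union hD))
    (Set.ncard_le_ncard hI (hC.inter_of_left _))

/-- A connected set meeting a set which is closed under adjacency within it lies inside it. -/
theorem ConnSet.subset_of_closed (hC : ConnSet G C) {S : Set V} (hx : x ∈ C) (hxS : x ∈ S)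
    (hS : ∀ a ∈ C, ∀ b ∈ C, G.Adj a b → a ∈ S → b ∈ S) : C ⊆ S := by
  intro y hy
  obtain ⟨p⟩ := hC.preconnected ⟨x, hx⟩ ⟨y, hy⟩
  by_contra hyS
  obtain ⟨d, -, h₁, h₂⟩ := p.exists_boundary_dart (Subtype.val ⁻¹' S) hxS hyS
  exact h₂ (hS _ d.fst.2 _ d.snd.2 d.adj h₁)

theorem connSet_of_closed (hx : x ∈ C)
    (h : ∀ S : Set V, x ∈ S → (∀ a ∈ C, ∀ b ∈ C, G.Adj a b → a ∈ S → b ∈ S) → C ⊆ S) :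
    ConnSet G C := by
  have key : ∀ y : C, (G.induce C).Reachable ⟨x, hx⟩ y := by
    rintro ⟨y, hy⟩
    obtain ⟨_, hr⟩ := h {v | ∃ hv : v ∈ C, (G.induce C).Reachable ⟨x, hx⟩ ⟨v, hv⟩}
      ⟨hx, SimpleGraph.Reachable.refl _⟩ (by
        rintro a - b hb hab ⟨ha, hr⟩
        refine ⟨hb, hr.trans (SimpleGraph.Adj.reachable ?_)⟩
        exact hab) hy
    exact hr
  exact (SimpleGraph.connected_iff_exists_forall_reachable _).2 ⟨⟨x, hx⟩, key⟩

theorem SimpleGraph.Connected.eq_univ_of_closed (hG : G.Connected) {S : Set V} (hx : x ∈ S)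
    (hS : ∀ a b, G.Adj a b → a ∈ S → b ∈ S) (y : V) : y ∈ S := by
  obtain ⟨p⟩ := hG.preconnected x y
  by_contra hy
  obtain ⟨d, -, h₁, h₂⟩ := p.exists_boundary_dart S hx hy
  exact h₂ (hS _ _ d.adj h₁)

theorem eq_or_eq_compl_of_edgeBoundary_eq (hG : G.Connected)
    (h : edgeBoundary G C = edgeBoundary G D) : C = D ∨ C = Dᶜ := by
  have key : ∀ a b, G.Adj a b → ((a ∈ C ↔ b ∈ C) ↔ (a ∈ D ↔ b ∈ D)) := by
    intro a b hab
    have := congrArg (s(a, b) ∈ ·) h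
    simp only [mk_mem_edgeBoundary, hab, true_and, eq_iff_iff] at this
    tauto
  obtain ⟨x⟩ := hG.nonempty
  by_cases hx : x ∈ C ↔ x ∈ D
  · exact Or.inl <| Set.ext <| hG.eq_univ_of_closed (S := {v | v ∈ C ↔ v ∈ D}) hx
      fun a b hab ha => by have := key a b hab; simp only [Set.mem_ofPred_eq] at *; tauto
  · refine Or.inr <| Set.ext <| hG.eq_univ_of_closed (S := {v | v ∈ C ↔ v ∈ Dᶜ}) (x := x) ?_
      fun a b hab ha => ?_
    · simp only [Set.mem_ofPred_eq, Set.mem_compl_iff]; tauto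
    · have := key a b hab
      simp only [Set.mem_ofPred_eq, Set.mem_compl_iff] at *
      tauto

end Boundary

section Component

variable {V : Type*} {G : SimpleGraph V} {A : Set V} {x : V}

/-- The connected component of `x` in the subgraph induced on `A`, for `x ∈ A`. -/
def componentIn (G : SimpleGraph V) (A : Set V) (x : V) : Set V :=
  {y | Relation.ReflTransGen (fun a b => G.Adj a b ∧ b ∈ A) x y}

theorem mem_componentIn_self : x ∈ componentIn G A x := Relation.ReflTransGen.refl

theorem mem_componentIn_of_adj {a b : V} (ha : a ∈ componentIn G A x) (hab : G.Adj a b)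
    (hb : b ∈ A) : b ∈ componentIn G A x :=
  Relation.ReflTransGen.tail ha ⟨hab, hb⟩

theorem componentIn_subset (hx : x ∈ A) : componentIn G A x ⊆ A := by
  intro y hy
  induction hy with
  | refl => exact hx
  | tail _ h _ => exact h.2

theorem connSet_componentIn : ConnSet G (componentIn G A x) := by
  refine connSet_of_closed mem_componentIn_self fun S hxS hS y hy => ?_
  induction hy with
  | refl => exact hxS
  | tail h hab ih => exact hS _ h _ (mem_componentIn_of_adj h hab.1 hab.2) hab.1 ih

theorem edgeBoundary_componentIn_subset (hx : x ∈ A) :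
    edgeBoundary G (componentIn G A x) ⊆ edgeBoundary G A := by
  intro e
  induction e with | _ a b =>
  simp only [mk_mem_edgeBoundary]
  rintro ⟨hab, h⟩
  refine ⟨hab, fun hA => h ⟨fun ha => ?_, fun hb => ?_⟩⟩
  · exact mem_componentIn_of_adj ha hab (hA.1 (componentIn_subset hx ha))
  · exact mem_componentIn_of_adj hb hab.symm (hA.2 (componentIn_subset hx hb))

theorem HasRay.mono {B : Set V} (hA : HasRay G A) (h : A ⊆ B) : HasRay G B := by
  obtain ⟨r, hr, hadj, hmem⟩ := hA
  exact ⟨r, hr, hadj, fun n => h (hmem n)⟩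

theorem HasRay.exists_componentIn (hA : HasRay G A) :
    ∃ x ∈ A, HasRay G (componentIn G A x) := by
  obtain ⟨r, hr, hadj, hmem⟩ := hA
  refine ⟨r 0, hmem 0, r, hr, hadj, fun n => ?_⟩
  induction n with
  | zero => exact mem_componentIn_self
  | succ n ih => exact mem_componentIn_of_adj ih (hadj n) (hmem _)

/-- In a connected graph, removing a component of the complement of a connected set
leaves a connected set. -/
theorem connSet_compl_componentIn_compl (hG : G.Connected) {K : Set V} (hK : ConnSet G K)
    (hx : x ∉ K) : ConnSet G (componentIn G Kᶜ x)ᶜ := by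
  set L := componentIn G Kᶜ x
  have hLK : L ⊆ Kᶜ := componentIn_subset hx
  have hKL : K ⊆ Lᶜ := Set.subset_compl_comm.1 hLK
  obtain ⟨k, hk⟩ := hK.nonempty
  refine connSet_of_closed (hKL hk) fun S hkS hS v hv => ?_
  have hKS : K ⊆ S := hK.subset_of_closed hk hkS
    fun a ha b hb => hS a (hKL ha) b (hKL hb)
  by_contra hvS
  refine (hG.eq_univ_of_closed (S := Lᶜ ∩ Sᶜ) ⟨hv, hvS⟩ ?_ k).2 hkS
  rintro a b hab ⟨haL, haS⟩
  have hbL : b ∉ L := fun hb => haL (mem_componentIn_of_adj hb hab.symm fun ha => haS (hKS ha))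
  exact ⟨hbL, fun hb => haS (hS b hbL a haL hab.symm hb)⟩

/-- A set with finite boundary both of whose sides contain a ray can be replaced by a cut
with a smaller boundary. -/
theorem exists_isCut_edgeBoundary_subset (hG : G.Connected) (hfin : (edgeBoundary G A).Finite)
    (h₁ : HasRay G A) (h₂ : HasRay G Aᶜ) :
    ∃ L, IsCut G L ∧ edgeBoundary G L ⊆ edgeBoundary G A := by
  obtain ⟨x, hx, hK⟩ := h₁.exists_componentIn
  have hKA := componentIn_subset (G := G) hx
  obtain ⟨z, hz, hL⟩ := (h₂.mono (Set.compl_subset_compl.2 hKA)).exists_componentIn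
  have hsub : edgeBoundary G (componentIn G (componentIn G A x)ᶜ z) ⊆ edgeBoundary G A := by
    refine (edgeBoundary_componentIn_subset hz).trans ?_
    rw [edgeBoundary_compl]
    exact edgeBoundary_componentIn_subset hx
  exact ⟨_, ⟨hfin.subset hsub, connSet_componentIn,
    connSet_compl_componentIn_compl hG connSet_componentIn hz, hL,
    hK.mono (Set.subset_compl_comm.1 (componentIn_subset hz))⟩, hsub⟩

end Component

section Cuts

variable {V : Type*} {G : SimpleGraph V} {A C D E : Set V}

theorem HasRay.inter_or_inter_compl (hC : HasRay G C) (hD : (edgeBoundary G D).Finite) :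
    HasRay G (C ∩ D) ∨ HasRay G (C ∩ Dᶜ) := by
  obtain ⟨r, hr, hadj, hmem⟩ := hC
  have hinj : Function.Injective fun n => s(r n, r (n + 1)) := by
    intro m n hmn
    rcases Sym2.eq_iff.1 hmn with ⟨h, -⟩ | ⟨h, h'⟩
    · exact hr h
    · have := hr h
      have := hr h'
      omega
  obtain ⟨N, hN⟩ := (hD.preimage hinj.injOn).bddAbove
  have hstep : ∀ n, (r (N + 1 + n) ∈ D ↔ r (N + 1 + (n + 1)) ∈ D) := by
    intro n
    by_contra h
    have : N + 1 + n ≤ N := hN (mk_mem_edgeBoundary.2 ⟨hadj _, h⟩)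
    omega
  have hall : ∀ n, (r (N + 1 + n) ∈ D ↔ r (N + 1) ∈ D) := by
    intro n
    induction n with
    | zero => rfl
    | succ n ih => exact (hstep n).symm.trans ih
  have hinj' : Function.Injective fun n => r (N + 1 + n) := fun m n h => by
    have := hr h
    omega
  by_cases h : r (N + 1) ∈ D
  · exact Or.inl ⟨_, hinj', fun n => hadj _, fun n => ⟨hmem _, (hall n).2 h⟩⟩
  · exact Or.inr ⟨_, hinj', fun n => hadj _, fun n => ⟨hmem _, fun h' => h ((hall n).1 h')⟩⟩

theorem IsCut.compl (hC : IsCut G C) : IsCut G Cᶜ := by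
  obtain ⟨h₁, h₂, h₃, h₄, h₅⟩ := hC
  exact ⟨by rwa [edgeBoundary_compl], h₃, by rwa [compl_compl], h₅, by rwa [compl_compl]⟩

theorem IsMinCut.compl (hC : IsMinCut G C) : IsMinCut G Cᶜ :=
  ⟨hC.1.compl, by rw [edgeBoundary_compl]; exact hC.2⟩

theorem IsMinCut.ncard_le (hG : G.Connected) (hC : IsMinCut G C)
    (hfin : (edgeBoundary G A).Finite) (h₁ : HasRay G A) (h₂ : HasRay G Aᶜ) :
    (edgeBoundary G C).ncard ≤ (edgeBoundary G A).ncard := by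
  obtain ⟨L, hL, hLA⟩ := exists_isCut_edgeBoundary_subset hG hfin h₁ h₂
  exact (hC.2 L hL).trans (Set.ncard_le_ncard hLA hfin)

theorem IsMinCut.isMinCut_of_ncard_le (hG : G.Connected) (hC : IsMinCut G C)
    (hfin : (edgeBoundary G A).Finite) (h₁ : HasRay G A) (h₂ : HasRay G Aᶜ)
    (hle : (edgeBoundary G A).ncard ≤ (edgeBoundary G C).ncard) : IsMinCut G A := by
  obtain ⟨L, hL, hLA⟩ := exists_isCut_edgeBoundary_subset hG hfin h₁ h₂
  have heq : edgeBoundary G A = edgeBoundary G L :=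
    (Set.eq_of_subset_of_ncard_le hLA (hle.trans (hC.2 L hL)) hfin).symm
  have hLmin : IsMinCut G L := ⟨hL, fun D hD => heq ▸ hle.trans (hC.2 D hD)⟩
  rcases eq_or_eq_compl_of_edgeBoundary_eq hG heq with rfl | rfl
  · exact hLmin
  · exact hLmin.compl

theorem IsMinCut.isMinCut_corners (hG : G.Connected) (hC : IsMinCut G C) (hD : IsMinCut G D)
    (h₁ : HasRay G (C ∩ D)) (h₂ : HasRay G (Cᶜ ∩ Dᶜ)) :
    IsMinCut G (C ∩ D) ∧ IsMinCut G (Cᶜ ∩ Dᶜ) := by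
  obtain ⟨f₁, f₂, hle⟩ := ncard_edgeBoundary_corners_le hC.1.1 hD.1.1
  have h₁' : HasRay G (C ∩ D)ᶜ :=
    h₂.mono fun v hv hv' => hv.1 hv'.1
  have h₂' : HasRay G (Cᶜ ∩ Dᶜ)ᶜ :=
    h₁.mono fun v hv hv' => hv'.1 hv.1
  have hCD := hC.2 D hD.1
  have hDC := hD.2 C hC.1
  have l₁ := hC.ncard_le hG f₁ h₁ h₁'
  have l₂ := hC.ncard_le hG f₂ h₂ h₂'
  exact ⟨hC.isMinCut_of_ncard_le hG f₁ h₁ h₁' (by omega),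
    hC.isMinCut_of_ncard_le hG f₂ h₂ h₂' (by omega)⟩

/-- Finitely many sets with connected sides and boundary of bounded size separate two
given vertices. -/
theorem finite_separating (G : SimpleGraph V) (x y : V) (n : ℕ) (F : Set (Sym2 V)) :
    {C : Set V | x ∈ C ∧ y ∉ C ∧ ConnSet G C ∧ ConnSet G Cᶜ ∧ (edgeBoundary G C).Finite ∧
      F ⊆ edgeBoundary G C ∧ (edgeBoundary G C \ F).ncard < n}.Finite := by
  classical
  induction n generalizing F with
  | zero => simp
  | succ n ih =>
  by_cases hr : (G.deleteEdges F).Reachable x y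
  · obtain ⟨p⟩ := hr
    have key : ∀ C : Set V, x ∈ C → y ∉ C →
        ∃ e ∈ p.edges.toFinset, e ∈ edgeBoundary G C ∧ e ∉ F := by
      intro C hx hy
      obtain ⟨d, hd, h₁, h₂⟩ := p.exists_boundary_dart C hx hy
      have hadj := SimpleGraph.deleteEdges_adj.1 d.adj
      exact ⟨s(d.fst, d.snd), List.mem_toFinset.2 (List.mem_map.2 ⟨d, hd, rfl⟩),
        mk_mem_edgeBoundary.2 ⟨hadj.1, fun h => h₂ (h.1 h₁)⟩, hadj.2⟩
    refine (p.edges.toFinset.finite_toSet.biUnion fun e _ => ih (insert e F)).subset ?_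
    rintro C ⟨hx, hy, hC, hC', hfin, hF, hn⟩
    obtain ⟨e, hep, heC, heF⟩ := key C hx hy
    refine Set.mem_biUnion hep ⟨hx, hy, hC, hC', hfin, Set.insert_subset heC hF, ?_⟩
    have : (edgeBoundary G C \ insert e F).ncard < (edgeBoundary G C \ F).ncard := by
      refine Set.ncard_lt_ncard ⟨fun a ha => ⟨ha.1, fun h => ha.2 (Or.inr h)⟩, fun h => ?_⟩
        hfin.sdiff
      exact (h ⟨heC, heF⟩).2 (Or.inl rfl)
    omega
  · refine (Set.finite_singleton {v | (G.deleteEdges F).Reachable x v}).subset ?_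
    rintro C ⟨hx, hy, hC, hC', hfin, hF, hn⟩
    have hsame : ∀ a b, G.Adj a b → (a ∈ C ↔ b ∈ C) → (G.deleteEdges F).Reachable a b :=
      fun a b hab h => SimpleGraph.Adj.reachable <| SimpleGraph.deleteEdges_adj.2
        ⟨hab, fun he => (mk_mem_edgeBoundary.1 (hF he)).2 h⟩
    have h₁ : C ⊆ {v | (G.deleteEdges F).Reachable x v} :=
      hC.subset_of_closed hx (SimpleGraph.Reachable.refl _) fun a ha b hb hab h =>
        h.trans (hsame a b hab (iff_of_true ha hb))
    have h₂ : Cᶜ ⊆ {v | (G.deleteEdges F).Reachable y v} :=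
      hC'.subset_of_closed hy (SimpleGraph.Reachable.refl _) fun a ha b hb hab h =>
        h.trans (hsame a b hab (iff_of_false ha hb))
    refine Set.Subset.antisymm h₁ fun v hv => ?_
    by_contra hvC
    exact hr (SimpleGraph.Reachable.trans hv (h₂ hvC).symm)

theorem Nested.symm (h : Nested C D) : Nested D C := by
  rcases h with h | h | h | h
  · exact Or.inr (Or.inl h)
  · exact Or.inl h
  · exact Or.inr (Or.inr (Or.inl (by rwa [Set.inter_comm])))
  · exact Or.inr (Or.inr (Or.inr (by rwa [Set.union_comm])))

theorem nested_compl_right : Nested C Dᶜ ↔ Nested C D := by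
  rw [Nested, Nested, ← Set.disjoint_iff_inter_eq_empty, ← Set.disjoint_iff_inter_eq_empty,
    Set.disjoint_compl_right_iff_subset, Set.subset_compl_iff_disjoint_right,
    ← Set.compl_subset_iff_union, ← Set.compl_subset_iff_union, Set.compl_subset_compl,
    Set.compl_subset_comm]
  tauto

theorem Mset_compl : Mset G Cᶜ = Mset G C := by
  ext E
  simp only [Mset, Set.mem_ofPred_eq, nested_compl_right]

/-- A connected set containing no endpoint of an edge in the boundary of `C` lies in `C` or
in its complement. -/
theorem ConnSet.subset_or_subset_compl (hD : ConnSet G D)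
    (h : ∀ a ∈ D, ∀ b, s(a, b) ∉ edgeBoundary G C) : D ⊆ C ∨ D ⊆ Cᶜ := by
  obtain ⟨x, hx⟩ := hD.nonempty
  have hsame : ∀ a ∈ D, ∀ b, G.Adj a b → (a ∈ C ↔ b ∈ C) := fun a ha b hab => by
    by_contra hn
    exact h a ha b (mk_mem_edgeBoundary.2 ⟨hab, hn⟩)
  by_cases hxC : x ∈ C
  · exact Or.inl (hD.subset_of_closed hx hxC fun a ha b _ hab => (hsame a ha b hab).1)
  · exact Or.inr (hD.subset_of_closed hx hxC
      fun a ha b _ hab haC hbC => haC ((hsame a ha b hab).2 hbC))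

theorem finite_Mset (hC : IsMinCut G C) : (Mset G C).Finite := by
  set W : Set V := {a | ∃ e ∈ edgeBoundary G C, a ∈ e}
  have hW : W.Finite := by
    have : W = ⋃ e ∈ edgeBoundary G C, {a | a ∈ e} := by
      ext a
      simp [W]
    rw [this]
    refine hC.1.1.biUnion fun e _ => ?_
    induction e with | _ a b =>
    refine (Set.toFinite {a, b}).subset fun v hv => ?_
    simpa using hv
  have hbig := hW.biUnion fun x _ => hW.biUnion fun y _ =>
    finite_separating G x y ((edgeBoundary G C).ncard + 1) ∅
  refine hbig.subset ?_
  rintro D ⟨hD, hn⟩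
  have side : ∀ E : Set V, ConnSet G E → ¬ Nested E C → ∃ x ∈ W, x ∈ E := by
    intro E hE hEC
    by_contra! hno
    rcases hE.subset_or_subset_compl (C := C)
      (fun a ha b hab => hno a ⟨_, hab, Sym2.mem_mk_left _ _⟩ ha) with h | h
    · exact hEC (Or.inl h)
    · exact hEC (nested_compl_right.1 (Or.inl h))
  obtain ⟨x, hxW, hx⟩ := side D hD.1.2.1 hn
  obtain ⟨y, hyW, hy⟩ := side Dᶜ hD.1.2.2.1
    fun h => hn (nested_compl_right.1 h.symm).symm
  refine Set.mem_biUnion hxW (Set.mem_biUnion hyW ⟨hx, hy, hD.1.2.1, hD.1.2.2.1, hD.1.1,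
    Set.empty_subset _, ?_⟩)
  rw [Set.sdiff_empty]
  exact Nat.lt_succ_of_le (hD.2 C hC.1)

theorem Nested.inter (hCD : ¬ Nested C D) (hC : Nested E C) (hD : Nested E D) :
    Nested E (C ∩ D) := by
  simp only [Nested, Set.subset_def, Set.eq_empty_iff_forall_notMem, Set.eq_univ_iff_forall,
    Set.mem_inter_iff, Set.mem_union] at *
  grind

theorem Nested.inter_or_inter_compl (h : Nested E C) :
    Nested E (C ∩ D) ∨ Nested E (Cᶜ ∩ Dᶜ) := by
  simp only [Nested, Set.subset_def, Set.eq_empty_iff_forall_notMem, Set.eq_univ_iff_forall,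
    Set.mem_inter_iff, Set.mem_union, Set.mem_compl_iff] at *
  grind

theorem nested_compl_compl : Nested Cᶜ Dᶜ ↔ Nested C D :=
  nested_compl_right.trans ⟨fun h => (nested_compl_right.1 h.symm).symm,
    fun h => (nested_compl_right.2 h.symm).symm⟩

theorem ncard_Mset_corners_lt (hC : IsMinCut G C) (hD : IsMinCut G D) (hCD : ¬ Nested C D)
    (h₁ : IsMinCut G (C ∩ D)) (h₂ : IsMinCut G (Cᶜ ∩ Dᶜ)) :
    (Mset G (C ∩ D)).ncard + (Mset G (Cᶜ ∩ Dᶜ)).ncard <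
      (Mset G C).ncard + (Mset G D).ncard := by
  have fC := finite_Mset hC
  have fD := finite_Mset hD
  have hU : Mset G (C ∩ D) ∪ Mset G (Cᶜ ∩ Dᶜ) ⊂ Mset G C ∪ Mset G D := by
    refine ⟨?_, fun h => ?_⟩
    · rintro E (⟨hE, hn⟩ | ⟨hE, hn⟩)
      · by_contra hno
        simp only [Mset, Set.mem_union, Set.mem_ofPred_eq, hE, true_and, not_or, not_not] at hno
        exact hn (Nested.inter hCD hno.1 hno.2)
      · by_contra hno
        simp only [Mset, Set.mem_union, Set.mem_ofPred_eq, hE, true_and, not_or, not_not] at hno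
        exact hn (Nested.inter (mt nested_compl_compl.1 hCD) (nested_compl_right.2 hno.1)
          (nested_compl_right.2 hno.2))
    · rcases h (Or.inr ⟨hC, hCD⟩ : C ∈ Mset G C ∪ Mset G D) with h | h
      · exact h.2 (Or.inr (Or.inl Set.inter_subset_left))
      · refine h.2 (Or.inr (Or.inr (Or.inl ?_)))
        rw [← Set.inter_assoc, Set.inter_compl_self, Set.empty_inter]
  have hI : Mset G (C ∩ D) ∩ Mset G (Cᶜ ∩ Dᶜ) ⊆ Mset G C ∩ Mset G D := by
    rintro E ⟨⟨hE, hn₁⟩, -, hn₂⟩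
    refine ⟨⟨hE, fun h => ?_⟩, hE, fun h => ?_⟩
    · exact h.inter_or_inter_compl.elim hn₁ hn₂
    · refine (h.inter_or_inter_compl (D := C)).elim ?_ ?_
      · rwa [Set.inter_comm]
      · rwa [Set.inter_comm]
  rw [← Set.ncard_union_add_ncard_inter _ _ (finite_Mset h₁) (finite_Mset h₂),
    ← Set.ncard_union_add_ncard_inter _ _ fC fD]
  exact add_lt_add_of_lt_of_le (Set.ncard_lt_ncard hU (fC.union fD))
    (Set.ncard_le_ncard hI (fC.inter_of_left _))

theorem OptimallyNested.compl (hC : OptimallyNested G C) : OptimallyNested G Cᶜ :=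
  ⟨hC.1.compl, by rw [Mset_compl]; exact hC.2⟩

theorem OptimallyNested.nested_of_hasRay (hG : G.Connected) (hC : OptimallyNested G C)
    (hD : OptimallyNested G D) (h₁ : HasRay G (C ∩ D)) (h₂ : HasRay G (Cᶜ ∩ Dᶜ)) :
    Nested C D := by
  by_contra hCD
  obtain ⟨m₁, m₂⟩ := hC.1.isMinCut_corners hG hD.1 h₁ h₂
  have := ncard_Mset_corners_lt hC.1 hD.1 hCD m₁ m₂
  have := hC.2 _ m₁
  have := hD.2 _ m₂
  omega

end Cuts

/-- Optimally nested cuts are nested with all other optimally nested cuts. -/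
theorem optimallyNested_nested {V : Type*} (G : SimpleGraph V) (hG : G.Connected)
    (hcut : ∃ A : Set V, IsCut G A) (C D : Set V)
    (hC : OptimallyNested G C) (hD : OptimallyNested G D) :
    Nested C D := by
  obtain ⟨fC, -, -, rC, rC'⟩ := hC.1.1
  obtain ⟨fD, -, -, rD, rD'⟩ := hD.1.1
  by_cases h : HasRay G (C ∩ D) ∧ HasRay G (Cᶜ ∩ Dᶜ)
  · exact hC.nested_of_hasRay hG hD h.1 h.2
  · have hCr := rC.inter_or_inter_compl fD
    have hCr' := rC'.inter_or_inter_compl fD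
    have hDr := rD.inter_or_inter_compl fC
    have hDr' := rD'.inter_or_inter_compl fC
    rw [Set.inter_comm D C, Set.inter_comm D] at hDr
    rw [Set.inter_comm Dᶜ C, Set.inter_comm Dᶜ] at hDr'
    refine nested_compl_right.1 (hC.nested_of_hasRay hG hD.compl (by tauto) ?_)
    rw [compl_compl]
    tauto
end
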